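/- Let G be a finite graph on n vertices and let k ≥ 2 be an integer such that every vertex u of G satisfies |N_k(u)| > n/2 − 1 (equivalently, 2|N_k(u)| > n − 2). Then G admits a rainbow coloring with 4k² + 2k colors, i.e., rc(G) ≤ 4k² + 2k. -/

import Mathlib

open SimpleGraph Finset

variable {V : Type*}

/-- `o` is an orientation of `G`: each edge of `G` gets exactly one direction. -/
def IsOrientation (G : SimpleGraph V) (o : V → V → Prop) : Prop :=
  (∀ x y, o x y → G.Adj x y) ∧ (∀ x y, G.Adj x y → (o x y ∨ o y x)) ∧
    (∀ x y, o x y → ¬ o y x)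

/-- There is a directed path (with respect to `o`) from `x` to `y` of length at most `n`. -/
def DPathLE (o : V → V → Prop) (n : ℕ) (x y : V) : Prop :=
  ∃ m ≤ n, ∃ f : ℕ → V, f 0 = x ∧ f m = y ∧ (∀ i < m, o (f i) (f (i + 1))) ∧
    (∀ i ≤ m, ∀ j ≤ m, f i = f j → i = j)

/-- `G` admits an orientation of radius at most `R`. -/
def OrientRadiusLE (G : SimpleGraph V) (R : ℕ) : Prop :=
  ∃ o : V → V → Prop, IsOrientation G o ∧
    ∃ u : V, ∀ v : V, DPathLE o R u v ∧ DPathLE o R v u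

/-- `G` admits an orientation of diameter at most `D`. -/
def OrientDiamLE (G : SimpleGraph V) (D : ℕ) : Prop :=
  ∃ o : V → V → Prop, IsOrientation G o ∧ ∀ x y : V, DPathLE o D x y

/-- The edge `e` lies on a cycle of `G` of length at most `n`. -/
def InCycleLE (G : SimpleGraph V) (e : Sym2 V) (n : ℕ) : Prop :=
  ∃ (v : V) (c : G.Walk v v), c.IsCycle ∧ e ∈ c.edges ∧ c.length ≤ n

/-- `G` is bridgeless: no edge is a cut edge. -/
def Bridgeless (G : SimpleGraph V) : Prop :=
  ∀ e ∈ G.edgeSet, ¬ G.IsBridge e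

/-- `c` is a rainbow `k`-edge-coloring of `G`: every two distinct vertices are joined
by a path whose edges receive pairwise distinct colors. -/
def IsRainbowColoring (G : SimpleGraph V) (k : ℕ) (c : Sym2 V → Fin k) : Prop :=
  ∀ x y : V, x ≠ y → ∃ p : G.Walk x y, p.IsPath ∧ (p.edges.map c).Nodup

/-- The rainbow connection number of `G` is at most `k`. -/
def RcLE (G : SimpleGraph V) (k : ℕ) : Prop :=
  ∃ c : Sym2 V → Fin k, IsRainbowColoring G k c

open Classical in
/-- Every graph has a 2-coloring in which every non-isolated vertex has a neighbor of the
other color. -/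
theorem exists_unfriendly (H : SimpleGraph V) :
    ∃ σ : V → Prop, ∀ a b, H.Adj a b → ∃ b', H.Adj a b' ∧ (σ a ↔ ¬ σ b') := by
  let r : V → V := fun a => (H.connectedComponentMk a).out
  have hr : ∀ a, H.Reachable a (r a) := fun a =>
    (ConnectedComponent.exact (Quot.out_eq (H.connectedComponentMk a))).symm
  have hrr : ∀ a b, H.Adj a b → r a = r b := fun a b h => by
    simp only [r]
    rw [ConnectedComponent.sound h.reachable]
  refine ⟨fun a => Even (H.dist a (r a)), fun a b hab => ?_⟩
  beta_reduce
  by_cases h0 : r a = a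
  · refine ⟨b, hab, ?_⟩
    rw [← hrr a b hab, h0]
    simp [SimpleGraph.dist_eq_one_iff_adj.2 hab.symm]
  · obtain ⟨p, hp⟩ := (hr a).exists_walk_length_eq_dist
    generalize hra : r a = ra at p
    cases p with
    | nil => exact absurd hra h0
    | @cons _ w _ h p =>
      refine ⟨w, h, ?_⟩
      rw [← hrr a w h, hra]
      have h1 : H.dist w ra ≤ p.length := dist_le p
      obtain ⟨q, hq⟩ := p.reachable.exists_walk_length_eq_dist
      have h2 := dist_le (Walk.cons h q)
      simp only [Walk.length_cons] at hp h2
      have h3 : H.dist a ra = H.dist w ra + 1 := by omega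
      rw [h3, Nat.even_add_one]

/-- Distance to a nonempty set in a connected graph, with parents. -/
theorem exists_setdist (G : SimpleGraph V) (hG : G.Connected) (D : Set V) (hD : D.Nonempty) :
    ∃ (d : V → ℕ) (par : V → V), (∀ v, d v = 0 ↔ v ∈ D) ∧ (∀ v w, G.Adj v w → d v ≤ d w + 1) ∧
      (∀ v, 0 < d v → G.Adj v (par v) ∧ d (par v) + 1 = d v) := by
  let d : V → ℕ := fun v => sInf ((G.dist v) '' D)
  have hle : ∀ v, ∀ u ∈ D, d v ≤ G.dist v u := fun v u hu => Nat.sInf_le ⟨u, hu, rfl⟩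
  have hat : ∀ v, ∃ u ∈ D, G.dist v u = d v := fun v => Nat.sInf_mem (hD.image (G.dist v))
  have hlip : ∀ v w, G.Adj v w → d v ≤ d w + 1 := by
    intro v w h
    obtain ⟨u, hu, e⟩ := hat w
    have h1 := hle v u hu
    obtain ⟨q, hq⟩ := (hG w u).exists_walk_length_eq_dist
    have h2 := dist_le (Walk.cons h q)
    simp only [Walk.length_cons] at h2
    omega
  have hpar : ∀ v, ∃ w, 0 < d v → G.Adj v w ∧ d w + 1 = d v := by
    intro v
    by_cases hv : 0 < d v
    · obtain ⟨u, hu, e⟩ := hat v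
      obtain ⟨q, hq⟩ := (hG v u).exists_walk_length_eq_dist
      cases q with
      | nil => simp only [Walk.length_nil] at hq; omega
      | @cons _ w _ h q =>
        refine ⟨w, fun _ => ⟨h, ?_⟩⟩
        have h1 := hle w u hu
        have h2 := dist_le q
        have h3 := hlip v w h
        simp only [Walk.length_cons] at hq
        omega
    · exact ⟨v, fun h => absurd h hv⟩
  choose par hpar using hpar
  refine ⟨d, par, fun v => ⟨fun h => ?_, fun h => ?_⟩, hlip, hpar⟩
  · obtain ⟨u, hu, e⟩ := hat v
    rw [h] at e
    rwa [(hG v u).dist_eq_zero_iff.1 e]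
  · have := hle v v h
    simpa using this

/-- Either the root `a` has a second neighbor in `D`, or its branch has a short exit. -/
theorem branch_exit (G : SimpleGraph V) (d : V → ℕ) (b : V → V) (n : ℕ)
    (hlip : ∀ v w, G.Adj v w → d v ≤ d w + 1) (hb1 : ∀ v, d v = 1 → b v = v) (a x0 : V)
    (hx0 : d x0 = 0) : ∀ (u : V) (p : G.Walk u x0), 0 < d u → b u = a → s(a, x0) ∉ p.edges →
      d u + p.length ≤ n →
      (∃ x', d x' = 0 ∧ x' ≠ x0 ∧ G.Adj a x') ∨
      (∃ y z, G.Adj y z ∧ 0 < d y ∧ 0 < d z ∧ b y = a ∧ b z ≠ a ∧ d y + d z + 1 ≤ n) := by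
  have hwalk : ∀ (u v : V) (p : G.Walk u v), d u ≤ d v + p.length := by
    intro u v p
    induction p with
    | nil => simp
    | cons h p ih =>
      have := hlip _ _ h
      simp only [Walk.length_cons]
      omega
  intro u p
  induction p with
  | nil => intro h; omega
  | @cons u w x0 h p ih =>
    intro hu hbu he hlen
    simp only [Walk.length_cons] at hlen
    simp only [Walk.edges_cons, List.mem_cons, not_or] at he
    have h1 := hlip _ _ h
    have h2 := hlip _ _ h.symm
    by_cases hw : d w = 0
    · left
      have hua : u = a := by rw [← hbu, hb1 u (by omega)]
      subst hua
      refine ⟨w, hw, ?_, h⟩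
      rintro rfl
      exact he.1 rfl
    · by_cases hbw : b w = a
      · exact ih hx0 (by omega) hbw he.2 (by omega)
      · right
        have := hwalk _ _ p
        exact ⟨u, w, h, hu, by omega, hbu, hbw, by omega⟩

open Classical in
theorem exists_ears (G : SimpleGraph V) (hG : G.Connected) (D : Set V) (hD : D.Nonempty) (n : ℕ)
    (hn : 2 ≤ n)
    (hcyc : ∀ x y, G.Adj x y → ∃ p : G.Walk x y, s(x, y) ∉ p.edges ∧ p.length + 1 ≤ n) :
    ∃ f : Sym2 V → ℕ, ∀ a, a ∉ D → (∃ x ∈ D, G.Adj a x) →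
      ∃ x ∈ D, ∃ x' ∈ D, ∃ W : G.Walk x x', a ∈ W.support ∧
        (W.edges.map f).Pairwise (· < ·) ∧ ∀ e ∈ W.edges, f e < n ∧ ∃ v ∈ e, v ∉ D := by
  obtain ⟨d, par, hd0, hlip, hpar⟩ := exists_setdist G hG D hD
  let b : V → V := fun v => par^[d v - 1] v
  have hb1 : ∀ v, d v = 1 → b v = v := fun v h => by simp [b, h]
  have hbpar : ∀ v, 1 < d v → b (par v) = b v := by
    intro v h
    have h1 := (hpar v (by omega)).2
    have h2 : d v - 1 = (d (par v) - 1) + 1 := by omega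
    simp only [b]
    rw [h2, Function.iterate_succ_apply]
  let H : SimpleGraph V :=
    { Adj := fun a a' => a ≠ a' ∧ ∃ y z, G.Adj y z ∧ 0 < d y ∧ 0 < d z ∧ b y = a ∧ b z = a' ∧
        d y + d z + 1 ≤ n
      symm := ⟨by
        rintro a a' ⟨h, y, z, h1, h2, h3, h4, h5, h6⟩
        exact ⟨h.symm, z, y, h1.symm, h3, h2, h5, h4, by omega⟩⟩
      loopless := ⟨fun a h => h.1 rfl⟩ }
  obtain ⟨σ, hσ⟩ := exists_unfriendly H
  let w : V → ℕ := fun y => if 0 < d y ∧ σ (b y) then d y else 0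
  let f0 : Sym2 V → ℕ := Sym2.lift ⟨fun y z => max (w y) (w z), fun y z => max_comm _ _⟩
  let T : {v // 0 < d v} → Sym2 V := fun v => s(v.1, par v.1)
  have hT : Function.Injective T := by
    rintro ⟨v, hv⟩ ⟨v', hv'⟩ h
    simp only [T, Sym2.eq_iff] at h
    have h1 := (hpar v hv).2
    have h2 := (hpar v' hv').2
    rcases h with ⟨h, -⟩ | ⟨h, h'⟩
    · exact Subtype.ext h
    · rw [h'] at h1
      rw [← h] at h2
      omega
  let τ : {v // 0 < d v} → ℕ := fun v => if σ (b v.1) then d v.1 - 1 else n - d v.1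
  let f : Sym2 V → ℕ := Function.extend T τ f0
  have hfT : ∀ v, 0 < d v → f s(v, par v) = if σ (b v) then d v - 1 else n - d v := fun v hv =>
    hT.extend_apply τ f0 ⟨v, hv⟩
  -- the left walks
  have hL : ∀ m, ∀ y, d y = m → (0 < d y → σ (b y)) → ∃ x ∈ D, ∃ W : G.Walk x y,
      (0 < d y → b y ∈ W.support) ∧ (W.edges.map f).Pairwise (· < ·) ∧
      ∀ e ∈ W.edges, f e < d y ∧ ∃ v ∈ e, v ∉ D := by
    intro m
    induction m with
    | zero =>
      intro y hy _
      exact ⟨y, (hd0 y).1 hy, Walk.nil, by omega, by simp, by simp⟩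
    | succ m ih =>
      intro y hy hs
      obtain ⟨h1, h2⟩ := hpar y (by omega)
      obtain ⟨x, hx, W, hW1, hW2, hW3⟩ := ih (par y) (by omega) (fun h => by
        rw [hbpar y (by omega)]; exact hs (by omega))
      have hf : f s(par y, y) = d y - 1 := by
        rw [Sym2.eq_swap, hfT y (by omega), if_pos (hs (by omega))]
      refine ⟨x, hx, W.concat h1.symm, fun _ => ?_, ?_, ?_⟩
      · by_cases h : d y = 1
        · rw [hb1 y h]; simp
        · rw [← hbpar y (by omega), Walk.support_concat]
          simp [hW1 (by omega)]
      · rw [Walk.edges_concat, List.concat_eq_append, List.map_append, List.pairwise_append]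
        refine ⟨hW2, by simp, ?_⟩
        intro c hc c' hc'
        simp only [List.map_cons, List.map_nil, List.mem_singleton] at hc'
        obtain ⟨e, he, rfl⟩ := List.mem_map.1 hc
        have := (hW3 e he).1
        rw [hc', hf]
        omega
      · intro e he
        rw [Walk.edges_concat, List.concat_eq_append, List.mem_append, List.mem_singleton] at he
        rcases he with he | rfl
        · have := hW3 e he
          exact ⟨by omega, this.2⟩
        · refine ⟨by omega, y, by simp, fun h => ?_⟩
          have := (hd0 y).2 h
          omega
  -- the right walks
  have hR : ∀ m, ∀ y, d y = m → d y ≤ n → (0 < d y → ¬ σ (b y)) → ∃ x ∈ D, ∃ W : G.Walk y x,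
      (0 < d y → b y ∈ W.support) ∧ (W.edges.map f).Pairwise (· < ·) ∧
      ∀ e ∈ W.edges, n - d y ≤ f e ∧ f e < n ∧ ∃ v ∈ e, v ∉ D := by
    intro m
    induction m with
    | zero =>
      intro y hy _ _
      exact ⟨y, (hd0 y).1 hy, Walk.nil, by omega, by simp, by simp⟩
    | succ m ih =>
      intro y hy hyn hs
      obtain ⟨h1, h2⟩ := hpar y (by omega)
      obtain ⟨x, hx, W, hW1, hW2, hW3⟩ := ih (par y) (by omega) (by omega) (fun h => by
        rw [hbpar y (by omega)]; exact hs (by omega))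
      have hf : f s(y, par y) = n - d y := by
        rw [hfT y (by omega), if_neg (hs (by omega))]
      refine ⟨x, hx, W.cons h1, fun _ => ?_, ?_, ?_⟩
      · by_cases h : d y = 1
        · rw [hb1 y h]; simp
        · rw [← hbpar y (by omega), Walk.support_cons]
          simp [hW1 (by omega)]
      · rw [Walk.edges_cons, List.map_cons, List.pairwise_cons]
        refine ⟨?_, hW2⟩
        intro c hc
        obtain ⟨e, he, rfl⟩ := List.mem_map.1 hc
        have := (hW3 e he).1
        rw [hf]
        omega
      · intro e he
        rw [Walk.edges_cons, List.mem_cons] at he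
        rcases he with rfl | he
        · refine ⟨by omega, by omega, y, by simp, fun h => ?_⟩
          have := (hd0 y).2 h
          omega
        · have := hW3 e he
          exact ⟨by omega, this.2⟩
  -- the ears
  have key : ∀ y z, G.Adj y z → (0 < d y → σ (b y)) → (0 < d z → ¬ σ (b z)) →
      d y + d z + 1 ≤ n → 0 < d y + d z → (0 < d y → z ≠ par y) → (0 < d z → y ≠ par z) →
      ∃ x ∈ D, ∃ x' ∈ D, ∃ W : G.Walk x x', (0 < d y → b y ∈ W.support) ∧
        (0 < d z → b z ∈ W.support) ∧
        (W.edges.map f).Pairwise (· < ·) ∧ ∀ e ∈ W.edges, f e < n ∧ ∃ v ∈ e, v ∉ D := by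
    intro y z hyz hy hz hlen hpos hzp hyp
    obtain ⟨x, hx, W, hW1, hW2, hW3⟩ := hL _ y rfl hy
    obtain ⟨x', hx', W', hW1', hW2', hW3'⟩ := hR _ z rfl (by omega) hz
    have hf : f s(y, z) = d y := by
      have h1 : f s(y, z) = f0 s(y, z) := by
        apply Function.extend_apply'
        rintro ⟨⟨v, hv⟩, h⟩
        simp only [T, Sym2.eq_iff] at h
        rcases h with ⟨rfl, h⟩ | ⟨rfl, h⟩
        · exact hzp hv h.symm
        · exact hyp hv h.symm
      have h2 : w y = d y := by
        simp only [w]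
        split_ifs with h
        · rfl
        · by_contra h'
          exact h ⟨by omega, hy (by omega)⟩
      have h3 : w z = 0 := by
        simp only [w]
        rw [if_neg]
        rintro ⟨h, h'⟩
        exact hz h h'
      rw [h1]
      simp [f0, h2, h3]
    refine ⟨x, hx, x', hx', W.append (W'.cons hyz), fun h => ?_, fun h => ?_, ?_, ?_⟩
    · rw [Walk.mem_support_append_iff]; exact Or.inl (hW1 h)
    · rw [Walk.mem_support_append_iff, Walk.support_cons]
      exact Or.inr (List.mem_cons_of_mem _ (hW1' h))
    · rw [Walk.edges_append, Walk.edges_cons, List.map_append, List.map_cons,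
        List.pairwise_append, List.pairwise_cons]
      refine ⟨hW2, ⟨?_, hW2'⟩, ?_⟩
      · intro c hc
        obtain ⟨e, he, rfl⟩ := List.mem_map.1 hc
        have := (hW3' e he).1
        omega
      · intro c hc c' hc'
        obtain ⟨e, he, rfl⟩ := List.mem_map.1 hc
        have := (hW3 e he).1
        rcases List.mem_cons.1 hc' with rfl | hc'
        · omega
        · obtain ⟨e', he', rfl⟩ := List.mem_map.1 hc'
          have := (hW3' e' he').1
          omega
    · intro e he
      rw [Walk.edges_append, Walk.edges_cons, List.mem_append, List.mem_cons] at he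
      rcases he with he | rfl | he
      · have := hW3 e he
        exact ⟨by omega, this.2⟩
      · refine ⟨by omega, ?_⟩
        by_cases h : 0 < d y
        · exact ⟨y, by simp, fun h' => by have := (hd0 y).2 h'; omega⟩
        · exact ⟨z, by simp, fun h' => by have := (hd0 z).2 h'; omega⟩
      · exact (hW3' e he).2
  refine ⟨f, fun a ha hax => ?_⟩
  have hda : d a = 1 := by
    obtain ⟨x, hx, hax⟩ := hax
    have h1 := hlip _ _ hax
    have h2 := (hd0 x).2 hx
    have h3 := mt (hd0 a).1 ha
    omega
  obtain ⟨hap, hdp⟩ := hpar a (by omega)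
  obtain ⟨p, hp1, hp2⟩ := hcyc a (par a) hap
  rcases branch_exit G d b n hlip hb1 a (par a) (by omega) a p (by omega) (hb1 a hda) hp1
    (by omega) with ⟨x', hx', hne, hadj⟩ | ⟨y, z, h1, h2, h3, h4, h5, h6⟩
  · by_cases hsa : σ a
    · obtain ⟨x, hx, x', hx', W, k1, k2, k3⟩ := key a x' hadj (fun _ => (hb1 a hda).symm ▸ hsa)
        (fun h => by omega) (by omega) (by omega) (fun _ => hne) (fun h => by omega)
      exact ⟨x, hx, x', hx', W, (hb1 a hda) ▸ k1 (by omega), k3⟩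
    · obtain ⟨x, hx, x', hx', W, k1, k2, k3⟩ := key x' a hadj.symm (fun h => by omega)
        (fun _ => (hb1 a hda).symm ▸ hsa) (by omega) (by omega) (fun h => by omega) (fun _ => hne)
      exact ⟨x, hx, x', hx', W, (hb1 a hda) ▸ k2 (by omega), k3⟩
  · obtain ⟨a', ⟨hne, y, z, g1, g2, g3, g4, g5, g6⟩, hs⟩ := hσ a (b z) ⟨h5.symm, y, z, h1, h2, h3, h4, rfl, h6⟩
    have hnp : ∀ u v, 0 < d u → 0 < d v → b u ≠ b v → u ≠ par v := by
      rintro u v hu hv hb rfl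
      have := (hpar v hv).2
      exact hb (hbpar v (by omega))
    have hbne : b y ≠ b z := by rw [g4, g5]; exact hne
    by_cases hsa : σ a
    · obtain ⟨x, hx, x', hx', W, k1, k2, k3⟩ := key y z g1 (fun _ => g4 ▸ hsa)
        (fun _ => g5 ▸ hs.1 hsa) g6 (by omega)
        (fun _ => hnp _ _ g3 g2 hbne.symm) (fun _ => hnp _ _ g2 g3 hbne)
      exact ⟨x, hx, x', hx', W, g4 ▸ k1 g2, k3⟩
    · have hsa' : σ a' := by tauto
      obtain ⟨x, hx, x', hx', W, k1, k2, k3⟩ := key z y g1.symm (fun _ => g5 ▸ hsa')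
        (fun _ => g4 ▸ hsa) (by omega) (by omega)
        (fun _ => hnp _ _ g2 g3 hbne) (fun _ => hnp _ _ g3 g2 hbne.symm)
      exact ⟨x, hx, x', hx', W, g4 ▸ k2 g2, k3⟩

/-- All pairs in `D` are joined by rainbow walks inside `D` with colors `< N`. -/
def RainOn (G : SimpleGraph V) (c : Sym2 V → ℕ) (D : Set V) (N : ℕ) : Prop :=
  ∀ x ∈ D, ∀ y ∈ D, ∃ p : G.Walk x y,
    (∀ e ∈ p.edges, (∀ v ∈ e, v ∈ D) ∧ c e < N) ∧ (p.edges.map c).Nodup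

open Classical in
theorem rain_step (G : SimpleGraph V) (hG : G.Connected) (n : ℕ) (hn : 2 ≤ n)
    (hcyc : ∀ x y, G.Adj x y → ∃ p : G.Walk x y, s(x, y) ∉ p.edges ∧ p.length + 1 ≤ n)
    (D : Set V) (hD : D.Nonempty) (c : Sym2 V → ℕ) (N : ℕ) (hc : RainOn G c D N) :
    ∃ (D' : Set V) (c' : Sym2 V → ℕ), D ⊆ D' ∧ (∀ x ∈ D, ∀ y, G.Adj x y → y ∈ D') ∧
      RainOn G c' D' (N + n) := by
  obtain ⟨f, hf⟩ := exists_ears G hG D hD n hn hcyc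
  let Ear : ∀ x x' : V, G.Walk x x' → Prop := fun x x' W => x ∈ D ∧ x' ∈ D ∧
    (W.edges.map f).Pairwise (· < ·) ∧ ∀ e ∈ W.edges, f e < n ∧ ∃ v ∈ e, v ∉ D
  let D' : Set V := D ∪ {v | ∃ x x' W, Ear x x' W ∧ v ∈ W.support}
  let c' : Sym2 V → ℕ := fun e => if ∀ v ∈ e, v ∈ D then c e else N + f e
  have hDD' : D ⊆ D' := Set.subset_union_left
  -- every vertex has two ways to reach `D`
  have hsplit : ∀ v ∈ D', ∃ i : ℕ, ∃ x ∈ D, ∃ x' ∈ D, ∃ (A : G.Walk v x) (B : G.Walk v x'),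
      (A.edges.map c').Nodup ∧ (B.edges.map c').Nodup ∧
      (∀ e ∈ A.edges, (∀ v ∈ e, v ∈ D') ∧ N ≤ c' e ∧ c' e < N + n ∧ c' e < N + i) ∧
      (∀ e ∈ B.edges, (∀ v ∈ e, v ∈ D') ∧ N ≤ c' e ∧ c' e < N + n ∧ N + i ≤ c' e) := by
    intro v hv
    rcases hv with hv | ⟨x, x', W, hW, hvW⟩
    · exact ⟨0, v, hv, v, hv, Walk.nil, Walk.nil, by simp, by simp, by simp, by simp⟩
    · obtain ⟨hx, hx', h1, h2⟩ := id hW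
      have hc' : ∀ e ∈ W.edges, c' e = N + f e := by
        intro e he
        obtain ⟨-, v, hv, hvD⟩ := h2 e he
        exact if_neg fun h => hvD (h v hv)
      have hsub : ∀ e ∈ W.edges, ∀ u ∈ e, u ∈ D' := by
        intro e he u hu
        exact Or.inr ⟨x, x', W, hW, Walk.mem_support_of_mem_edges he hu⟩
      have hWe : W.edges = (W.takeUntil v hvW).edges ++ (W.dropUntil v hvW).edges := by
        rw [← Walk.edges_append, Walk.take_spec]
      generalize W.takeUntil v hvW = A at hWe
      generalize W.dropUntil v hvW = B at hWe
      have hlt : (W.edges.map c').Pairwise (· < ·) := by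
        rw [List.map_congr_left hc']
        rw [List.pairwise_map] at h1 ⊢
        exact h1.imp (fun h => by omega)
      rw [hWe, List.map_append, List.pairwise_append] at hlt
      obtain ⟨hA, hB, hAB⟩ := hlt
      have hmA : ∀ e ∈ A.edges, e ∈ W.edges := fun e he => by rw [hWe]; simp [he]
      have hmB : ∀ e ∈ B.edges, e ∈ W.edges := fun e he => by rw [hWe]; simp [he]
      obtain ⟨i, hi1, hi2⟩ : ∃ i, (∀ e ∈ A.edges, f e < i) ∧ (∀ e ∈ B.edges, i ≤ f e) := by
        cases hB' : B.edges with
        | nil => exact ⟨n, fun e he => (h2 e (hmA e he)).1, by simp⟩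
        | cons e0 l =>
          have he0 : e0 ∈ B.edges := by simp [hB']
          refine ⟨f e0, fun e he => ?_, ?_⟩
          · have := hAB (c' e) (List.mem_map_of_mem he) (c' e0) (List.mem_map_of_mem he0)
            rw [hc' e (hmA e he), hc' e0 (hmB _ he0)] at this
            omega
          · intro e he
            rw [← hB'] at he
            rcases List.mem_cons.1 (hB' ▸ he) with rfl | he'
            · exact le_rfl
            · rw [hB', List.map_cons, List.pairwise_cons] at hB
              have := hB.1 (c' e) (List.mem_map_of_mem he')
              rw [hc' e (hmB e he), hc' e0 (hmB _ he0)] at this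
              omega
      refine ⟨i, x, hx, x', hx', A.reverse, B, ?_, ?_, ?_, ?_⟩
      · rw [Walk.edges_reverse, List.map_reverse, List.nodup_reverse]
        exact hA.imp (fun h => ne_of_lt h)
      · exact hB.imp (fun h => ne_of_lt h)
      · intro e he
        rw [Walk.edges_reverse, List.mem_reverse] at he
        have h3 := hc' e (hmA e he)
        have h4 := (h2 e (hmA e he)).1
        have h5 := hi1 e he
        exact ⟨hsub e (hmA e he), by omega, by omega, by omega⟩
      · intro e he
        have h3 := hc' e (hmB e he)
        have h4 := (h2 e (hmB e he)).1
        have h5 := hi2 e he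
        exact ⟨hsub e (hmB e he), by omega, by omega, by omega⟩
  -- gluing
  have glue : ∀ (i : ℕ) (v w x y : V) (_ : x ∈ D) (_ : y ∈ D) (A : G.Walk v x) (B : G.Walk w y),
      (A.edges.map c').Nodup → (B.edges.map c').Nodup →
      (∀ e ∈ A.edges, (∀ v ∈ e, v ∈ D') ∧ N ≤ c' e ∧ c' e < N + n ∧ c' e < N + i) →
      (∀ e ∈ B.edges, (∀ v ∈ e, v ∈ D') ∧ N ≤ c' e ∧ c' e < N + n ∧ N + i ≤ c' e) →
      ∃ p : G.Walk v w,
        (∀ e ∈ p.edges, (∀ v ∈ e, v ∈ D') ∧ c' e < N + n) ∧ (p.edges.map c').Nodup := by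
    intro i v w x y hx hy A B hA hB hA' hB'
    obtain ⟨p, hp1, hp2⟩ := hc x hx y hy
    have hcp : ∀ e ∈ p.edges, c' e = c e := fun e he => if_pos (hp1 e he).1
    refine ⟨A.append (p.append B.reverse), ?_, ?_⟩
    · intro e he
      simp only [Walk.edges_append, Walk.edges_reverse, List.mem_append, List.mem_reverse] at he
      rcases he with he | he | he
      · exact ⟨(hA' e he).1, (hA' e he).2.2.1⟩
      · refine ⟨fun v hv => hDD' ((hp1 e he).1 v hv), ?_⟩
        have := (hp1 e he).2
        rw [hcp e he]
        omega
      · exact ⟨(hB' e he).1, (hB' e he).2.2.1⟩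
    · simp only [Walk.edges_append, Walk.edges_reverse, List.map_append, List.map_reverse]
      rw [List.nodup_append, List.nodup_append, List.nodup_reverse]
      refine ⟨hA, ⟨by rw [List.map_congr_left hcp]; exact hp2, hB, ?_⟩, ?_⟩
      · intro a ha b hb
        rw [List.mem_reverse] at hb
        obtain ⟨e, he, rfl⟩ := List.mem_map.1 ha
        obtain ⟨e', he', rfl⟩ := List.mem_map.1 hb
        have h1 := (hp1 e he).2
        have h2 := hcp e he
        have h3 := (hB' e' he').2.1
        omega
      · intro a ha b hb
        rw [List.mem_append, List.mem_reverse] at hb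
        obtain ⟨e, he, rfl⟩ := List.mem_map.1 ha
        have h4 := (hA' e he).2
        rcases hb with hb | hb
        · obtain ⟨e', he', rfl⟩ := List.mem_map.1 hb
          have h1 := (hp1 e' he').2
          have h2 := hcp e' he'
          omega
        · obtain ⟨e', he', rfl⟩ := List.mem_map.1 hb
          have h3 := (hB' e' he').2
          omega
  refine ⟨D', c', hDD', ?_, ?_⟩
  · intro x hx y hxy
    by_cases hy : y ∈ D
    · exact hDD' hy
    · obtain ⟨x1, h1, x2, h2, W, h3, h4⟩ := hf y hy ⟨x, hx, hxy.symm⟩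
      exact Or.inr ⟨x1, x2, W, ⟨h1, h2, h4⟩, h3⟩
  · intro v hv w hw
    obtain ⟨i, x, hx, x', hx', A, B, hA, hB, hA', hB'⟩ := hsplit v hv
    obtain ⟨j, y, hy, y', hy', A1, B1, hA1, hB1, hA1', hB1'⟩ := hsplit w hw
    rcases le_total i j with hij | hij
    · refine glue i v w x y' hx hy' A B1 hA hB1 hA' (fun e he => ?_)
      have := hB1' e he
      exact ⟨this.1, by omega, by omega, by omega⟩
    · obtain ⟨p, hp1, hp2⟩ := glue j w v y x' hy hx' A1 B hA1 hB hA1' (fun e he => by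
        have := hB' e he
        exact ⟨this.1, by omega, by omega, by omega⟩)
      refine ⟨p.reverse, fun e he => hp1 e (by simpa using he), ?_⟩
      rw [Walk.edges_reverse, List.map_reverse, List.nodup_reverse]
      exact hp2

theorem rain_iter (G : SimpleGraph V) (hG : G.Connected) (n : ℕ) (hn : 2 ≤ n)
    (hcyc : ∀ x y, G.Adj x y → ∃ p : G.Walk x y, s(x, y) ∉ p.edges ∧ p.length + 1 ≤ n) (u : V)
    (r : ℕ) : ∃ (D : Set V) (c : Sym2 V → ℕ), (∀ v, G.dist v u ≤ r → v ∈ D) ∧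
      RainOn G c D (r * n) := by
  induction r with
  | zero =>
    refine ⟨{u}, fun _ => 0, fun v hv => ?_, ?_⟩
    · exact (hG v u).dist_eq_zero_iff.1 (by omega)
    · rintro x rfl y rfl
      exact ⟨Walk.nil, by simp, by simp⟩
  | succ r ih =>
    obtain ⟨D, c, h1, h2⟩ := ih
    obtain ⟨D', c', h3, h4, h5⟩ := rain_step G hG n hn hcyc D ⟨u, h1 u (by simp)⟩ c _ h2
    refine ⟨D', c', fun v hv => ?_, by rw [Nat.succ_mul]; exact h5⟩
    obtain ⟨q, hq⟩ := (hG v u).exists_walk_length_eq_dist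
    cases q with
    | nil => exact h3 (h1 _ (by simp))
    | @cons _ w _ h q =>
      have h6 := dist_le q
      simp only [Walk.length_cons] at hq
      exact h4 w (h1 w (by omega)) v h.symm

theorem not_mem_shortest (G : SimpleGraph V) (x y w : V) (p : G.Walk x w) (k : ℕ)
    (hp : p.length = k) (hy : G.dist y w = k) (hxy : x ≠ y) : s(x, y) ∉ p.edges := by
  classical
  intro h
  have hys : y ∈ p.support := Walk.mem_support_of_mem_edges h (by simp)
  have h1 := congrArg Walk.length (p.take_spec hys)
  rw [Walk.length_append] at h1
  have h2 := dist_le (p.dropUntil y hys)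
  have h3 : (p.takeUntil y hys).length ≠ 0 := fun h => hxy (Walk.eq_of_length_eq_zero h)
  omega

/-- If `k ≥ 2` and every vertex `u` of an `n`-vertex graph `G` satisfies
`|N_k(u)| > n/2 - 1` (i.e. `2|N_k(u)| > n - 2`), then `G` admits a rainbow coloring with
`4k² + 2k` colors, i.e. `rc(G) ≤ 4k² + 2k`. -/
theorem rc_large_kth_neighborhood [Fintype V] [Nonempty V]
    (G : SimpleGraph V) (k : ℕ) (hk : 2 ≤ k)
    (hN : ∀ u : V, (Fintype.card V : ℤ) - 2 < 2 * ({v : V | G.dist u v = k} : Set V).ncard) :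
    RcLE G (4 * k ^ 2 + 2 * k) := by
  classical
  have hw : ∀ x y : V, x ≠ y → G.dist x y ≠ k → ∃ w, G.dist x w = k ∧ G.dist y w = k := by
    intro x y hxy hd
    by_contra! hcon
    let A : Finset V := Finset.univ.filter (fun v => G.dist x v = k)
    let B : Finset V := Finset.univ.filter (fun v => G.dist y v = k)
    have hA := hN x
    have hB := hN y
    have eA : ({v : V | G.dist x v = k} : Set V) = (A : Set V) := by ext; simp [A]
    have eB : ({v : V | G.dist y v = k} : Set V) = (B : Set V) := by ext; simp [B]
    rw [eA, Set.ncard_coe_finset] at hA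
    rw [eB, Set.ncard_coe_finset] at hB
    have hAB : Disjoint A B := by
      rw [Finset.disjoint_left]
      intro v hv hv'
      simp only [A, B, Finset.mem_filter, Finset.mem_univ, true_and] at hv hv'
      exact hcon v hv hv'
    have hP : Disjoint (A ∪ B) {x, y} := by
      rw [Finset.disjoint_right]
      intro v hv hv'
      simp only [A, B, Finset.mem_union, Finset.mem_filter, Finset.mem_univ, true_and,
        Finset.mem_insert, Finset.mem_singleton] at hv hv'
      rcases hv with rfl | rfl
      · rcases hv' with h | h
        · simp at h; omega
        · exact hd (by rw [SimpleGraph.dist_comm]; exact h)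
      · rcases hv' with h | h
        · exact hd h
        · simp at h; omega
    have h1 := Finset.card_le_univ ((A ∪ B) ∪ {x, y})
    rw [Finset.card_union_of_disjoint hP, Finset.card_union_of_disjoint hAB,
      Finset.card_pair hxy] at h1
    omega
  have hreach : ∀ x y, G.dist x y = k → G.Reachable x y := fun x y h =>
    SimpleGraph.Reachable.of_dist_ne_zero (by omega)
  have hG : G.Connected := by
    refine ⟨fun x y => ?_⟩
    by_cases hxy : x = y
    · rw [hxy]
    by_cases hd : G.dist x y = k
    · exact hreach x y hd
    · obtain ⟨w, h1, h2⟩ := hw x y hxy hd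
      exact (hreach x w h1).trans (hreach y w h2).symm
  have hdiam : ∀ x y, G.dist x y ≤ 2 * k := by
    intro x y
    by_cases hxy : x = y
    · rw [hxy]; simp
    by_cases hd : G.dist x y = k
    · omega
    · obtain ⟨w, h1, h2⟩ := hw x y hxy hd
      have := hG.dist_triangle (u := x) (v := w) (w := y)
      rw [SimpleGraph.dist_comm (u := w)] at this
      omega
  have hcyc : ∀ x y, G.Adj x y →
      ∃ p : G.Walk x y, s(x, y) ∉ p.edges ∧ p.length + 1 ≤ 2 * k + 1 := by
    intro x y hxy
    obtain ⟨w, h1, h2⟩ := hw x y hxy.ne (by rw [SimpleGraph.dist_eq_one_iff_adj.2 hxy]; omega)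
    obtain ⟨p, hp⟩ := (hG x w).exists_walk_length_eq_dist
    obtain ⟨q, hq⟩ := (hG y w).exists_walk_length_eq_dist
    refine ⟨p.append q.reverse, ?_, ?_⟩
    · rw [Walk.edges_append, Walk.edges_reverse, List.mem_append, List.mem_reverse, not_or]
      refine ⟨not_mem_shortest G x y w p k (by omega) h2 hxy.ne, ?_⟩
      rw [Sym2.eq_swap]
      exact not_mem_shortest G y x w q k (by omega) h1 hxy.ne'
    · rw [Walk.length_append, Walk.length_reverse]
      omega
  obtain ⟨u⟩ := ‹Nonempty V›
  obtain ⟨D, c, hD, hc⟩ := rain_iter G hG (2 * k + 1) (by omega) hcyc u (2 * k)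
  have hM : 2 * k * (2 * k + 1) = 4 * k ^ 2 + 2 * k := by ring
  rw [hM] at hc
  have hpos : 0 < 4 * k ^ 2 + 2 * k := by omega
  refine ⟨fun e => ⟨c e % (4 * k ^ 2 + 2 * k), Nat.mod_lt _ hpos⟩, fun x y _ => ?_⟩
  obtain ⟨p, hp1, hp2⟩ := hc x (hD x (hdiam x u)) y (hD y (hdiam y u))
  refine ⟨p.bypass, p.bypass_isPath, ?_⟩
  refine List.Nodup.map_on ?_ p.bypass_isPath.isTrail.edges_nodup
  intro e he e' he' h
  have m1 := Walk.edges_bypass_subset_edges p he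
  have m2 := Walk.edges_bypass_subset_edges p he'
  have h' := congrArg Fin.val h
  simp only [Nat.mod_eq_of_lt (hp1 e m1).2, Nat.mod_eq_of_lt (hp1 e' m2).2] at h'
  exact List.inj_on_of_nodup_map hp2 m1 m2 h'
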